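/- The polynomial f(x) = (x^3 − 7)(x^3 − 2141)(x^3 − 7·2141)(x^3 − 7^2·2141) = (x^3 − 7)(x^3 − 2141)(x^3 − 14987)(x^3 − 104909) has a root modulo every positive integer; that is, for every integer m ≥ 1 there exists x ∈ ℤ with m dividing f(x). -/

import Mathlib

/-- Hensel lifting for the polynomial `X ^ 3 - a`. -/
theorem exists_pow_dvd_cube_sub_of_norm_lt {p : ℕ} [Fact p.Prime] {a x : ℤ}
    (h : ‖((x ^ 3 - a : ℤ) : ℤ_[p])‖ < ‖((3 * x ^ 2 : ℤ) : ℤ_[p])‖ ^ 2) (k : ℕ) :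
    ∃ y : ℤ, ((p ^ k : ℕ) : ℤ) ∣ y ^ 3 - a := by
  obtain ⟨z, hz, -⟩ := hensels_lemma (p := p) (R := ℤ)
    (F := Polynomial.X ^ 3 - Polynomial.C a) (a := (x : ℤ_[p]))
    (by simpa [map_ofNat (Polynomial.aeval (x : ℤ_[p]))] using h)
  obtain ⟨y, hy⟩ := ZMod.intCast_surjective (PadicInt.toZModPow k z)
  refine ⟨y, (ZMod.intCast_zmod_eq_zero_iff_dvd _ (p ^ k)).1 ?_⟩
  have hz' := congrArg (PadicInt.toZModPow k) hz
  simpa [← hy] using hz'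

theorem exists_pow_dvd_cube_sub {p : ℕ} (hp : p.Prime) (hp3 : p ≠ 3) {a x : ℤ}
    (ha : ¬ (p : ℤ) ∣ a) (hx : (p : ℤ) ∣ x ^ 3 - a) (k : ℕ) :
    ∃ y : ℤ, ((p ^ k : ℕ) : ℤ) ∣ y ^ 3 - a := by
  have : Fact p.Prime := ⟨hp⟩
  have hpx : ¬ (p : ℤ) ∣ 3 * x ^ 2 := by
    intro h
    rcases (Nat.prime_iff_prime_int.1 hp).dvd_or_dvd h with h | h
    · exact hp3 ((Nat.prime_dvd_prime_iff_eq hp Nat.prime_three).1 (by exact_mod_cast h))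
    · have h' := (Nat.prime_iff_prime_int.1 hp).dvd_of_dvd_pow h
      exact ha ((dvd_sub_right (h'.trans (dvd_pow_self x three_ne_zero))).1 hx)
  refine exists_pow_dvd_cube_sub_of_norm_lt (x := x) ?_ k
  have h1 : ‖((3 * x ^ 2 : ℤ) : ℤ_[p])‖ = 1 :=
    le_antisymm (PadicInt.norm_le_one _)
      (not_lt.1 fun h => hpx ((PadicInt.norm_int_lt_one_iff_dvd _).1 h))
  rw [h1, one_pow]
  exact (PadicInt.norm_int_lt_one_iff_dvd _).2 hx

/-- In a cyclic group, one of `a`, `b`, `a * b`, `a ^ 2 * b` is a cube. -/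
theorem IsCyclic.exists_cube_eq {G : Type*} [CommGroup G] [IsCyclic G] (a b : G) :
    ∃ c : G, c ^ 3 = a ∨ c ^ 3 = b ∨ c ^ 3 = a * b ∨ c ^ 3 = a ^ 2 * b := by
  obtain ⟨g, hg⟩ := IsCyclic.exists_generator (α := G)
  obtain ⟨i, rfl⟩ := Subgroup.mem_zpowers_iff.1 (hg a)
  obtain ⟨j, rfl⟩ := Subgroup.mem_zpowers_iff.1 (hg b)
  have key : ∃ n : ℤ, n * 3 = i ∨ n * 3 = j ∨ n * 3 = i + j ∨ n * 3 = i * 2 + j := by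
    by_cases h1 : i % 3 = 0
    · exact ⟨i / 3, by omega⟩
    by_cases h2 : j % 3 = 0
    · exact ⟨j / 3, by omega⟩
    by_cases h3 : (i + j) % 3 = 0
    · exact ⟨(i + j) / 3, by omega⟩
    · have h4 : (i * 2 + j) % 3 = 0 := by
        have hi : i % 3 = 1 ∨ i % 3 = 2 := by omega
        have hj : j % 3 = 1 ∨ j % 3 = 2 := by omega
        rcases hi with hi | hi <;> rcases hj with hj | hj <;> omega
      exact ⟨(i * 2 + j) / 3, by omega⟩
  obtain ⟨n, hn⟩ := key
  have e3 : (g ^ n) ^ 3 = g ^ (n * 3) := by rw [zpow_mul]; exact (zpow_natCast _ _).symm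
  have e2 : (g ^ i) ^ 2 = g ^ (i * 2) := by rw [zpow_mul]; exact (zpow_natCast _ _).symm
  refine ⟨g ^ n, ?_⟩
  rw [e3, e2, ← zpow_add, ← zpow_add]
  rcases hn with h | h | h | h <;> simp [h]

/-- Modulo a prime not dividing `a * b`, one of `a`, `b`, `a * b`, `a ^ 2 * b` is a cube. -/
theorem exists_prime_dvd_cube_sub {p : ℕ} (hp : p.Prime) {a b : ℤ}
    (ha : ¬ (p : ℤ) ∣ a) (hb : ¬ (p : ℤ) ∣ b) :
    ∃ x : ℤ, (p : ℤ) ∣ x ^ 3 - a ∨ (p : ℤ) ∣ x ^ 3 - b ∨ (p : ℤ) ∣ x ^ 3 - a * b ∨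
      (p : ℤ) ∣ x ^ 3 - a ^ 2 * b := by
  have : Fact p.Prime := ⟨hp⟩
  have ha' : (a : ZMod p) ≠ 0 := fun h => ha ((ZMod.intCast_zmod_eq_zero_iff_dvd a p).1 h)
  have hb' : (b : ZMod p) ≠ 0 := fun h => hb ((ZMod.intCast_zmod_eq_zero_iff_dvd b p).1 h)
  obtain ⟨c, hc⟩ := IsCyclic.exists_cube_eq (Units.mk0 _ ha') (Units.mk0 _ hb')
  obtain ⟨x, hx⟩ := ZMod.intCast_surjective (c : ZMod p)
  refine ⟨x, ?_⟩
  simp only [← ZMod.intCast_zmod_eq_zero_iff_dvd _ p, Int.cast_sub, Int.cast_pow, Int.cast_mul,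
    sub_eq_zero, hx]
  simpa [Units.ext_iff] using hc

theorem exists_prime_pow_dvd {p : ℕ} (hp : p.Prime) (k : ℕ) :
    ∃ x : ℤ, ((p ^ k : ℕ) : ℤ) ∣
      (x ^ 3 - 7) * (x ^ 3 - 2141) * (x ^ 3 - 14987) * (x ^ 3 - 104909) := by
  suffices h : ∃ x : ℤ, ((p ^ k : ℕ) : ℤ) ∣ x ^ 3 - 7 ∨ ((p ^ k : ℕ) : ℤ) ∣ x ^ 3 - 2141 ∨
      ((p ^ k : ℕ) : ℤ) ∣ x ^ 3 - 14987 ∨ ((p ^ k : ℕ) : ℤ) ∣ x ^ 3 - 104909 by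
    obtain ⟨x, h | h | h | h⟩ := h
    · exact ⟨x, ((h.mul_right _).mul_right _).mul_right _⟩
    · exact ⟨x, ((h.mul_left _).mul_right _).mul_right _⟩
    · exact ⟨x, (h.mul_left _).mul_right _⟩
    · exact ⟨x, h.mul_left _⟩
  by_cases hp3 : p = 3
  · subst hp3
    have : Fact (Nat.Prime 3) := ⟨hp⟩
    have hlt : ‖((2 ^ 3 - 2141 : ℤ) : ℤ_[3])‖ < ‖((3 * 2 ^ 2 : ℤ) : ℤ_[3])‖ ^ 2 := by
      have h1 : ‖((2 ^ 3 - 2141 : ℤ) : ℤ_[3])‖ ≤ ((3 : ℕ) : ℝ) ^ (-(3 : ℕ) : ℤ) :=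
        PadicInt.norm_int_le_pow_iff_dvd.2 (by norm_num)
      have h3 : ((3 : ℕ) : ℝ)⁻¹ ≤ ‖((3 * 2 ^ 2 : ℤ) : ℤ_[3])‖ := by
        have h4 : ‖((2 ^ 2 : ℤ) : ℤ_[3])‖ = 1 :=
          le_antisymm (PadicInt.norm_le_one _) (not_lt.1 fun h =>
            absurd ((PadicInt.norm_int_lt_one_iff_dvd _).1 h) (by norm_num))
        have h5 := PadicInt.norm_p (p := 3)
        rw [Int.cast_mul, norm_mul, h4, mul_one]
        exact le_of_eq h5.symm
      refine h1.trans_lt (lt_of_lt_of_le ?_ (pow_le_pow_left₀ (by norm_num) h3 2))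
      norm_num
    obtain ⟨y, hy⟩ := exists_pow_dvd_cube_sub_of_norm_lt hlt k
    exact ⟨y, .inr (.inl hy)⟩
  by_cases hp7 : (p : ℤ) ∣ 7
  · obtain rfl : p = 7 :=
      (Nat.prime_dvd_prime_iff_eq hp (by norm_num)).1 (by exact_mod_cast hp7)
    obtain ⟨y, hy⟩ := exists_pow_dvd_cube_sub hp hp3 (a := 2141) (x := 6)
      (by norm_num) (by norm_num) k
    exact ⟨y, .inr (.inl hy)⟩
  by_cases hpq : (p : ℤ) ∣ 2141
  · obtain rfl : p = 2141 :=
      (Nat.prime_dvd_prime_iff_eq hp (by norm_num)).1 (by exact_mod_cast hpq)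
    obtain ⟨y, hy⟩ := exists_pow_dvd_cube_sub hp hp3 (a := 7) (x := 1077)
      (by norm_num) (by norm_num) k
    exact ⟨y, .inl hy⟩
  have hpp := Nat.prime_iff_prime_int.1 hp
  have h7q : ¬ (p : ℤ) ∣ 7 * 2141 := hpp.not_dvd_mul hp7 hpq
  have h77q : ¬ (p : ℤ) ∣ 7 ^ 2 * 2141 :=
    hpp.not_dvd_mul (fun h => hp7 (hpp.dvd_of_dvd_pow h)) hpq
  obtain ⟨x, hx | hx | hx | hx⟩ := exists_prime_dvd_cube_sub hp hp7 hpq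
  · obtain ⟨y, hy⟩ := exists_pow_dvd_cube_sub hp hp3 hp7 hx k
    exact ⟨y, .inl hy⟩
  · obtain ⟨y, hy⟩ := exists_pow_dvd_cube_sub hp hp3 hpq hx k
    exact ⟨y, .inr (.inl hy)⟩
  · obtain ⟨y, hy⟩ := exists_pow_dvd_cube_sub hp hp3 h7q hx k
    exact ⟨y, .inr (.inr (.inl hy))⟩
  · obtain ⟨y, hy⟩ := exists_pow_dvd_cube_sub hp hp3 h77q hx k
    exact ⟨y, .inr (.inr (.inr hy))⟩

/-- A polynomial with a root modulo every prime power has a root modulo every positive integer. -/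
theorem Polynomial.exists_dvd_eval_of_prime_pow (f : Polynomial ℤ)
    (h : ∀ p k : ℕ, p.Prime → ∃ x : ℤ, ((p ^ k : ℕ) : ℤ) ∣ f.eval x) {m : ℕ} (hm : m ≠ 0) :
    ∃ x : ℤ, (m : ℤ) ∣ f.eval x := by
  induction m using Nat.recOnPrimeCoprime with
  | zero => exact absurd rfl hm
  | prime_pow p n hp => exact h p n hp
  | coprime a b ha hb hab iha ihb =>
    obtain ⟨x, hx⟩ := iha (by omega)
    obtain ⟨y, hy⟩ := ihb (by omega)
    have hab' : IsCoprime (a : ℤ) b := Nat.isCoprime_iff_coprime.2 hab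
    obtain ⟨u, v, huv⟩ := hab'
    have hzx : (a : ℤ) ∣ (x * (v * b) + y * (u * a)) - x :=
      ⟨u * (y - x), by linear_combination x * huv⟩
    have hzy : (b : ℤ) ∣ (x * (v * b) + y * (u * a)) - y :=
      ⟨v * (x - y), by linear_combination y * huv⟩
    refine ⟨x * (v * b) + y * (u * a), ?_⟩
    rw [Nat.cast_mul]
    exact IsCoprime.mul_dvd ⟨u, v, huv⟩
      ((dvd_iff_dvd_of_dvd_sub (hzx.trans (f.sub_dvd_eval_sub _ _))).2 hx)
      ((dvd_iff_dvd_of_dvd_sub (hzy.trans (f.sub_dvd_eval_sub _ _))).2 hy)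

/-- The polynomial `(x³-7)(x³-2141)(x³-14987)(x³-104909)` has a root modulo
every positive integer. -/
theorem stmt16 :
    ∀ m : ℕ, 1 ≤ m → ∃ x : ℤ,
      (m : ℤ) ∣ (x ^ 3 - 7) * (x ^ 3 - 2141) * (x ^ 3 - 14987) * (x ^ 3 - 104909) := by
  intro m hm
  have h := Polynomial.exists_dvd_eval_of_prime_pow
    ((.X ^ 3 - .C 7) * (.X ^ 3 - .C 2141) * (.X ^ 3 - .C 14987) * (.X ^ 3 - .C 104909))
    (fun p k hp => by simpa using exists_prime_pow_dvd hp k) (Nat.one_le_iff_ne_zero.1 hm)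
  simpa using h
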